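/- Under the edge-count process axioms, suppose additionally that there exist a real α > 0 and a natural number t₁ ≥ max(t₀, 4) such that almost surely t·Y(t) > α for all t ≥ t₁, where Y(t) := 𝓔(t)/(t(t+1)). Let y be the almost sure limit of the martingale Y(t). Then μ{y > 0} = 1; moreover, for every ε > 0 there exists γ > 0 such that μ{y < γ} < ε. -/

import Mathlib

open MeasureTheory Filter Topology

lemma pa_pull {Ω : Type*} {m m0 : MeasurableSpace Ω} (hm : m ≤ m0)
    (μ : Measure Ω) [IsProbabilityMeasure μ] {f D : Ω → ℝ}
    (hf : StronglyMeasurable[m] f) (hf' : MemLp f ⊤ μ) (hD : MemLp D ⊤ μ) :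
    ∫ ω, f ω * D ω ∂μ = ∫ ω, f ω * (μ[D|m]) ω ∂μ := by
  have hfD : Integrable (f * D) μ := (hD.mul (r := ⊤) hf').integrable le_top
  have h := condExp_mul_of_stronglyMeasurable_left (μ := μ) hf hfD (hD.integrable le_top)
  have h2 := integral_congr_ae h
  rw [integral_condExp hm] at h2
  exact h2

lemma pa_step {Ω : Type*} {m m0 : MeasurableSpace Ω} (hm : m ≤ m0)
    (μ : Measure Ω) [IsProbabilityMeasure μ] {g h b D : Ω → ℝ} (c : ℝ)
    (hg : StronglyMeasurable[m] g) (hh : StronglyMeasurable[m] h)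
    (hb : StronglyMeasurable[m] b)
    (hg' : MemLp g ⊤ μ) (hh' : MemLp h ⊤ μ) (hb' : MemLp b ⊤ μ) (hD : MemLp D ⊤ μ)
    (hg0 : ∀ ω, 0 ≤ g ω)
    (h1 : μ[D|m] =ᵐ[μ] b)
    (h2 : ∀ᵐ ω ∂μ, (μ[(fun ω => D ω ^ 2)|m]) ω ≤ b ω ^ 2 + b ω) :
    ∫ ω, g ω * (D ω - b ω) ∂μ = 0 ∧
    ∫ ω, g ω * (h ω + c * (D ω - b ω)) ^ 2 ∂μ
      ≤ ∫ ω, g ω * h ω ^ 2 ∂μ + c ^ 2 * ∫ ω, g ω * b ω ∂μ := by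
  have mulL : ∀ {u v : Ω → ℝ}, MemLp u ⊤ μ → MemLp v ⊤ μ → MemLp (fun ω => u ω * v ω) ⊤ μ :=
    fun hu hv => hv.mul (r := ⊤) hu
  have key : ∀ {f : Ω → ℝ}, StronglyMeasurable[m] f → MemLp f ⊤ μ →
      ∫ ω, f ω * D ω ∂μ = ∫ ω, f ω * b ω ∂μ := by
    intro f hf hf'
    rw [pa_pull hm μ hf hf' hD]
    apply integral_congr_ae
    filter_upwards [h1] with ω hω
    rw [hω]
  have I : ∀ {u : Ω → ℝ}, MemLp u ⊤ μ → Integrable u μ := fun hu => hu.integrable le_top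
  have hD2 : MemLp (fun ω => D ω ^ 2) ⊤ μ := by
    simpa [sq] using mulL hD hD
  have hgb := mulL hg' hb'
  have hgbb := mulL hgb hb'
  have hgh := mulL hg' hh'
  have hghh := mulL hgh hh'
  have k1 := key hg hg'
  have k2 := key (hg.mul hh) hgh
  have k3 := key (hg.mul hb) hgb
  have k4 : ∫ ω, g ω * D ω ^ 2 ∂μ ≤ ∫ ω, (g ω * b ω * b ω + g ω * b ω) ∂μ := by
    rw [pa_pull hm μ hg hg' hD2]
    have hnn : 0 ≤ᵐ[μ] μ[(fun ω => D ω ^ 2)|m] :=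
      condExp_nonneg (Eventually.of_forall fun ω => sq_nonneg (D ω))
    apply integral_mono_of_nonneg
    · filter_upwards [hnn] with ω hω
      exact mul_nonneg (hg0 ω) hω
    · exact (I hgbb).add (I hgb)
    · filter_upwards [h2] with ω hω
      have := mul_le_mul_of_nonneg_left hω (hg0 ω)
      linarith
  have hgD := mulL hg' hD
  have hghD := mulL hgh hD
  have hgbD := mulL hgb hD
  have hghb := mulL hgh hb'
  have hgD2 := mulL hg' hD2
  rw [integral_add (I hgbb) (I hgb)] at k4
  simp only [Pi.mul_apply] at k2 k3
  constructor
  · simp only [mul_sub]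
    rw [integral_sub (I hgD) (I hgb), k1, sub_self]
  · have e : (fun ω => g ω * (h ω + c * (D ω - b ω)) ^ 2) = fun ω =>
        (((((g ω * h ω * h ω) + (2 * c) * (g ω * h ω * D ω)) - (2 * c) * (g ω * h ω * b ω))
          + c ^ 2 * (g ω * D ω ^ 2)) - (2 * c ^ 2) * (g ω * b ω * D ω))
          + c ^ 2 * (g ω * b ω * b ω) := by
      funext ω; ring
    have e2 : (fun ω => g ω * h ω ^ 2) = fun ω => g ω * h ω * h ω := by
      funext ω; ring
    have i1 := I hghh
    have i2 := (I hghD).const_mul (2 * c)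
    have i3 := (I hghb).const_mul (2 * c)
    have i4 := (I hgD2).const_mul (c ^ 2)
    have i5 := (I hgbD).const_mul (2 * c ^ 2)
    have i6 := (I hgbb).const_mul (c ^ 2)
    rw [e, e2, integral_add (by exact (((i1.add i2).sub i3).add i4).sub i5) i6,
      integral_sub (by exact ((i1.add i2).sub i3).add i4) i5,
      integral_add (by exact (i1.add i2).sub i3) i4,
      integral_sub (by exact i1.add i2) i3, integral_add i1 i2]
    simp only [integral_const_mul]
    rw [k2, k3]
    nlinarith [mul_le_mul_of_nonneg_left k4 (sq_nonneg c)]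

/-- If `t · Y t` is eventually bounded below by `α > 0`, then the a.s. limit
`y` of the edge-count martingale `Y t = 𝓔 t / (t(t+1))` is almost surely
positive, with a quantitative lower-tail bound. -/
theorem pa_edge_limit_positive {Ω : Type*} {m0 : MeasurableSpace Ω}
    (μ : Measure Ω) [IsProbabilityMeasure μ] (ℱ : Filtration ℕ m0)
    (t₀ : ℕ) (ht₀ : 2 ≤ t₀) (E : ℕ → Ω → ℕ)
    (hadapted : ∀ t, Measurable[ℱ t] (E t))
    (hbounds : ∀ᵐ ω ∂μ, ∀ t, t₀ ≤ t → 0 < E t ω ∧ 2 * E t ω < t * (t + 1))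
    (hmono : ∀ᵐ ω ∂μ, ∀ t, t₀ ≤ t → E t ω ≤ E (t + 1) ω)
    (hcond : ∀ t, t₀ ≤ t →
      μ[(fun ω => (E (t + 1) ω : ℝ) - (E t ω : ℝ)) | ℱ t]
        =ᵐ[μ] fun ω => 2 * (E t ω : ℝ) / t)
    (hcond2 : ∀ t, t₀ ≤ t →
      ∀ᵐ ω ∂μ,
        (μ[(fun ω => ((E (t + 1) ω : ℝ) - (E t ω : ℝ)) ^ 2) | ℱ t]) ω
          < (2 * (E t ω : ℝ) / t) ^ 2 + 2 * (E t ω : ℝ) / t)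
    (α : ℝ) (hα : 0 < α) (t₁ : ℕ) (ht₁ : max t₀ 4 ≤ t₁)
    (hlb : ∀ᵐ ω ∂μ, ∀ t, t₁ ≤ t → α < (t : ℝ) * ((E t ω : ℝ) / (t * (t + 1))))
    (y : Ω → ℝ)
    (hy : ∀ᵐ ω ∂μ, Tendsto (fun t => (E t ω : ℝ) / (t * (t + 1))) atTop (𝓝 (y ω))) :
    μ {ω | 0 < y ω} = 1 ∧
      ∀ ε : ℝ, 0 < ε → ∃ γ : ℝ, 0 < γ ∧ μ {ω | y ω < γ} < ENNReal.ofReal ε := by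
  have ht₁0 : t₀ ≤ t₁ := (le_max_left _ _).trans ht₁
  have ht₁4 : 4 ≤ t₁ := (le_max_right _ _).trans ht₁
  have hSX : ∀ t, StronglyMeasurable[ℱ t] (fun ω => (E t ω : ℝ)) := fun t =>
    ((measurable_of_countable (fun n : ℕ => (n : ℝ))).comp (hadapted t)).stronglyMeasurable
  have hMX : ∀ t, t₀ ≤ t → MemLp (fun ω => (E t ω : ℝ)) ⊤ μ := by
    intro t ht
    refine memLp_top_of_bound ((hSX t).mono (ℱ.le t)).aestronglyMeasurable ((t * (t + 1) : ℕ) : ℝ) ?_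
    filter_upwards [hbounds] with ω hω
    have := (hω t ht).2
    rw [Real.norm_of_nonneg (Nat.cast_nonneg _)]
    exact_mod_cast (by omega : E t ω ≤ t * (t + 1))
  set Y : ℕ → Ω → ℝ := fun t ω => (E t ω : ℝ) / (t * (t + 1)) with hY
  have hSY : ∀ t, StronglyMeasurable[ℱ t] (Y t) := fun t => by
    simp only [hY, div_eq_mul_inv]
    exact (hSX t).mul_const _
  have hMY : ∀ t, t₀ ≤ t → MemLp (Y t) ⊤ μ := fun t ht => by
    simp only [hY, div_eq_mul_inv]
    exact (hMX t ht).mul_const _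
  have main : ∀ T, t₁ ≤ T →
      μ {ω | y ω < α / (2 * T)} ≤ ENNReal.ofReal (4 / (α * (T + 1))) := by
    intro T hT
    have hT0 : (0 : ℝ) < T := by
      have : 0 < T := by omega
      exact_mod_cast this
    have hlbT : ∀ᵐ ω ∂μ, α / T < Y T ω := by
      filter_upwards [hlb] with ω hω
      rw [div_lt_iff₀ hT0, mul_comm]
      exact hω T hT
    set g : Ω → ℝ := fun ω => (Y T ω)⁻¹ * (Y T ω)⁻¹ with hg
    have hginv : StronglyMeasurable[ℱ T] (fun ω => (Y T ω)⁻¹) :=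
      (hSY T).measurable.inv.stronglyMeasurable
    have hSg : StronglyMeasurable[ℱ T] g := hginv.mul hginv
    have hMinv : MemLp (fun ω => (Y T ω)⁻¹) ⊤ μ := by
      refine memLp_top_of_bound (hginv.mono (ℱ.le T)).aestronglyMeasurable (T / α) ?_
      filter_upwards [hlbT] with ω hω
      have h0 : 0 < α / T := by positivity
      rw [Real.norm_of_nonneg (inv_nonneg.2 (h0.trans hω).le), ← inv_div]
      exact inv_anti₀ h0 hω.le
    have hMg : MemLp g ⊤ μ := hMinv.mul (r := ⊤) hMinv
    have hg0 : ∀ ω, 0 ≤ g ω := fun ω => mul_self_nonneg _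
    have hmul : ∀ {u v : Ω → ℝ}, MemLp u ⊤ μ → MemLp v ⊤ μ → MemLp (fun ω => u ω * v ω) ⊤ μ :=
      fun hu hv => hv.mul (r := ⊤) hu
    have base : ∫ ω, g ω * Y T ω ∂μ ≤ T / α := by
      have : ∫ ω, g ω * Y T ω ∂μ ≤ ∫ ω, (T / α : ℝ) ∂μ := by
        refine integral_mono_ae ((hmul hMg (hMY T (ht₁0.trans hT))).integrable le_top)
          (integrable_const _) ?_
        filter_upwards [hlbT] with ω hω
        have h0 : 0 < α / T := by positivity
        have h1 : 0 < Y T ω := h0.trans hω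
        have : g ω * Y T ω = (Y T ω)⁻¹ := by
          simp only [hg]; field_simp
        rw [this, ← inv_div]
        exact inv_anti₀ h0 hω.le
      simpa using this
    have ind : ∀ t, T ≤ t → ∫ ω, g ω * Y t ω ∂μ ≤ T / α ∧
        ∫ ω, g ω * (Y t ω - Y T ω) ^ 2 ∂μ
          ≤ T / α * (1 / (T * (T + 1)) - 1 / (t * (t + 1))) := by
      intro t ht
      induction t, ht using Nat.le_induction with
      | base => exact ⟨base, by simp⟩
      | succ t ht ih =>
        have htt₀ : t₀ ≤ t := (ht₁0.trans hT).trans ht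
        have ht0 : (0 : ℝ) < t := hT0.trans_le (by exact_mod_cast ht)
        have hFT : (ℱ T) ≤ ℱ t := ℱ.mono ht
        have hSb : StronglyMeasurable[ℱ t] (fun ω => 2 * (E t ω : ℝ) / t) := by
          simp only [div_eq_mul_inv]
          exact ((hSX t).const_mul 2).mul_const _
        have hMb : MemLp (fun ω => 2 * (E t ω : ℝ) / t) ⊤ μ := by
          simp only [div_eq_mul_inv]
          exact ((hMX t htt₀).const_mul 2).mul_const _
        have hMD : MemLp (fun ω => (E (t + 1) ω : ℝ) - (E t ω : ℝ)) ⊤ μ :=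
          (hMX (t + 1) (by omega)).sub (hMX t htt₀)
        obtain ⟨s1, s2⟩ := pa_step (ℱ.le t) μ (1 / ((t + 1) * (t + 2)) : ℝ)
          (hSg.mono hFT) ((hSY t).sub ((hSY T).mono hFT)) hSb hMg
          ((hMY t htt₀).sub (hMY T (ht₁0.trans hT))) hMb hMD hg0 (hcond t htt₀)
          ((hcond2 t htt₀).mono fun ω hω => hω.le)
        simp only [Pi.sub_apply] at s2
        have stepY : ∀ ω, Y (t + 1) ω = Y t ω + (1 / ((t + 1) * (t + 2)) : ℝ) *
            ((E (t + 1) ω : ℝ) - (E t ω : ℝ) - 2 * (E t ω : ℝ) / t) := by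
          intro ω
          simp only [hY]
          push_cast
          field_simp
          ring
        constructor
        · have e : (fun ω => g ω * Y (t + 1) ω) = fun ω => g ω * Y t ω +
              (1 / ((t + 1) * (t + 2)) : ℝ) *
              (g ω * ((E (t + 1) ω : ℝ) - (E t ω : ℝ) - 2 * (E t ω : ℝ) / t)) := by
            funext ω; rw [stepY]; ring
          rw [e, integral_add ((hmul hMg (hMY t htt₀)).integrable le_top)
            (by exact ((hmul hMg (hMD.sub hMb)).integrable le_top).const_mul _), integral_const_mul, s1]
          simpa using ih.1
        · have e : (fun ω => g ω * (Y (t + 1) ω - Y T ω) ^ 2) = fun ω =>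
              g ω * (Y t ω - Y T ω + (1 / ((t + 1) * (t + 2)) : ℝ) *
              ((E (t + 1) ω : ℝ) - (E t ω : ℝ) - 2 * (E t ω : ℝ) / t)) ^ 2 := by
            funext ω; rw [stepY]; ring
          have e2 : (fun ω => g ω * (2 * (E t ω : ℝ) / t)) = fun ω =>
              (2 * (t + 1) : ℝ) * (g ω * Y t ω) := by
            funext ω; simp only [hY]; field_simp
          rw [e]
          refine s2.trans ?_
          rw [e2, integral_const_mul]
          have hTα : 0 ≤ T / α := by positivity
          have c1 : (1 / ((t + 1) * (t + 2)) : ℝ) ^ 2 * ((2 * (t + 1) : ℝ) *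
              ∫ ω, g ω * Y t ω ∂μ) ≤ T / α * (2 / (t * (t + 1) * (t + 2))) := by
            have q : (1 / ((t + 1) * (t + 2)) : ℝ) ^ 2 * (2 * (t + 1) : ℝ)
                ≤ 2 / (t * (t + 1) * (t + 2)) := by
              have : (1 / ((t + 1) * (t + 2)) : ℝ) ^ 2 * (2 * (t + 1) : ℝ)
                = 2 / ((t + 2) * (t + 1) * (t + 2)) := by field_simp
              rw [this]
              gcongr
              linarith
            rw [← mul_assoc]
            calc _ ≤ (1 / ((t + 1) * (t + 2)) : ℝ) ^ 2 * (2 * (t + 1) : ℝ) * (T / α) := by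
                  gcongr
                  exact ih.1
              _ ≤ 2 / (t * (t + 1) * (t + 2)) * (T / α) := by gcongr
              _ = _ := mul_comm _ _
          have c2 : (2 / (t * (t + 1) * (t + 2)) : ℝ)
              = 1 / (t * (t + 1)) - 1 / ((t + 1) * (t + 1 + 1)) := by
            field_simp
            ring
          rw [c2] at c1
          push_cast
          linarith [ih.2]
    have bd : ∀ t, T ≤ t → ∫⁻ ω, ENNReal.ofReal (g ω * (Y t ω - Y T ω) ^ 2) ∂μ
        ≤ ENNReal.ofReal (1 / (α * (T + 1))) := by
      intro t ht
      have hd := (hMY t ((ht₁0.trans hT).trans ht)).sub (hMY T (ht₁0.trans hT))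
      have hint : Integrable (fun ω => g ω * (Y t ω - Y T ω) ^ 2) μ := by
        simp only [sq]
        exact (hmul hMg (hmul hd hd)).integrable le_top
      rw [← ofReal_integral_eq_lintegral_ofReal hint
        (Eventually.of_forall fun ω => mul_nonneg (hg0 ω) (sq_nonneg _))]
      apply ENNReal.ofReal_le_ofReal
      refine (ind t ht).2.trans ?_
      have p : (0 : ℝ) ≤ 1 / (t * (t + 1)) := by positivity
      calc T / α * (1 / (T * (T + 1)) - 1 / (t * (t + 1)))
          ≤ T / α * (1 / (T * (T + 1))) := by
            apply mul_le_mul_of_nonneg_left _ (by positivity)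
            linarith
        _ = 1 / (α * (T + 1)) := by field_simp
    have hmeas : ∀ t, Measurable (fun ω => ENNReal.ofReal (g ω * (Y t ω - Y T ω) ^ 2)) := by
      intro t
      have a := ((hSY t).mono (ℱ.le t)).measurable
      have b := ((hSY T).mono (ℱ.le T)).measurable
      have c := (hSg.mono (ℱ.le T)).measurable
      exact (c.mul ((a.sub b).pow_const 2)).ennreal_ofReal
    have fatou := lintegral_liminf_le (μ := μ) (u := atTop) hmeas
    have fatou2 := fatou.trans (liminf_le_of_frequently_le'
      (((eventually_ge_atTop T).mono bd).frequently))
    have mk := meas_ge_le_lintegral_div (μ := μ)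
      (Measurable.liminf hmeas).aemeasurable (ε := ENNReal.ofReal (1 / 4))
      (by simp) ENNReal.ofReal_ne_top
    calc μ {ω | y ω < α / (2 * T)}
        ≤ μ {ω | ENNReal.ofReal (1 / 4) ≤
            liminf (fun t => ENNReal.ofReal (g ω * (Y t ω - Y T ω) ^ 2)) atTop} := by
          apply measure_mono_ae
          filter_upwards [hy, hlbT] with ω hω hω2 hlt
          have hlt : y ω < α / (2 * T) := hlt
          have lim : Tendsto (fun t => ENNReal.ofReal (g ω * (Y t ω - Y T ω) ^ 2)) atTop
              (𝓝 (ENNReal.ofReal (g ω * (y ω - Y T ω) ^ 2))) :=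
            ENNReal.tendsto_ofReal (((hω.sub_const _).pow 2).const_mul _)
          show ENNReal.ofReal (1 / 4) ≤ liminf _ _
          rw [lim.liminf_eq]
          apply ENNReal.ofReal_le_ofReal
          have h0 : 0 < α / T := by positivity
          have h1 : 0 < Y T ω := h0.trans hω2
          have h3 : α / (2 * T) = α / T / 2 := by field_simp
          have : g ω * (y ω - Y T ω) ^ 2 = (y ω - Y T ω) ^ 2 / (Y T ω) ^ 2 := by
            simp only [hg]; field_simp
          rw [this, le_div_iff₀ (by positivity)]
          nlinarith
      _ ≤ _ := mk
      _ ≤ ENNReal.ofReal (1 / (α * (T + 1))) / ENNReal.ofReal (1 / 4) := by gcongr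
      _ = ENNReal.ofReal (4 / (α * (T + 1))) := by
          rw [← ENNReal.ofReal_div_of_pos (by norm_num)]
          congr 1
          field_simp
  have second : ∀ ε : ℝ, 0 < ε → ∃ γ : ℝ, 0 < γ ∧ μ {ω | y ω < γ} < ENNReal.ofReal ε := by
    intro ε hε
    obtain ⟨n, hn⟩ := exists_nat_gt (4 / (α * ε))
    have hT : t₁ ≤ max n t₁ := le_max_right _ _
    have hn' : (n : ℝ) ≤ ((max n t₁ : ℕ) : ℝ) := by exact_mod_cast le_max_left n t₁
    generalize max n t₁ = T at hT hn'
    have hT0 : (0 : ℝ) < T := by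
      have : 0 < T := by omega
      exact_mod_cast this
    refine ⟨α / (2 * T), by positivity, (main T hT).trans_lt ?_⟩
    rw [ENNReal.ofReal_lt_ofReal_iff hε, div_lt_iff₀ (by positivity)]
    rw [div_lt_iff₀ (by positivity)] at hn
    nlinarith [mul_pos hα hε]
  refine ⟨?_, second⟩
  have hae : ∀ᵐ ω ∂μ, 0 < y ω := by
    rw [ae_iff]
    by_contra hne
    obtain ⟨γ, hγ, h⟩ := second (μ {ω | ¬ 0 < y ω}).toReal
      (ENNReal.toReal_pos hne (measure_ne_top _ _))
    rw [ENNReal.ofReal_toReal (measure_ne_top _ _)] at h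
    refine absurd h (not_lt.2 (measure_mono fun ω hω => ?_))
    exact (not_lt.1 hω).trans_lt hγ
  rw [measure_congr (eventuallyEq_univ.2 hae), measure_univ]
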